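/- (Proposition 5) For i = 1, 2, 3 and f ∈ B_{ε,η} define (Rᵢ^{α} f)(x) = ∫₀^∞ Rᵢ(x,y;α)·f(y) dy whenever the integral is absolutely convergent. Then: (i) if -1/2 ≤ Re α < 0 and 0 < ε, η < 1, then for every f ∈ B_{ε,η} the integral defining R₁^{α} f converges absolutely for every x > 0 and R₁^{α} f ∈ B_{ε,η}; (ii) if 0 < Re α ≤ 1/2 and 1 − Re α < ε, η < 1, then for every f ∈ B_{ε,η} the integral defining R₂^{α} f converges absolutely for every x > 0 and R₂^{α} f ∈ B_{ε,η}; (iii) if 0 < Re α ≤ 1/2 and 0 < ε, η < Re α, then for every f ∈ B_{ε,η} the integral defining R₃^{α} f converges absolutely for every x > 0 and R₃^{α} f ∈ B_{ε,η}. -/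

import Mathlib

open MeasureTheory Set Asymptotics

noncomputable section

/-- `r₁(x;α)` from Dixon's resolvent kernels. -/
def r1 (α : ℂ) (x : ℝ) : ℂ :=
  if α = -(1/2 : ℂ) then
    -(2 / (Real.pi : ℂ)) * ((x : ℂ) ^ ((1 : ℂ)/2) * (Real.log x : ℂ)) / (1 - (x : ℂ) ^ 2)
  else
    (1 / Complex.cos ((Real.pi : ℂ) * α)) *
      (((x : ℂ) ^ (-α) - (x : ℂ) ^ (α + 1)) / (1 - (x : ℂ) ^ 2))

def r2 (α : ℂ) (x : ℝ) : ℂ := -(1 / (x : ℂ)) * r1 (-α) x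

def r3 (α : ℂ) (x : ℝ) : ℂ := (x : ℂ) ^ 2 * r2 α x

def R1 (α : ℂ) (x y : ℝ) : ℂ := (1 / (y : ℂ)) * r1 α (x / y)
def R2 (α : ℂ) (x y : ℝ) : ℂ := (1 / (y : ℂ)) * r2 α (x / y)
def R3 (α : ℂ) (x y : ℝ) : ℂ := (1 / (y : ℂ)) * r3 α (x / y)

/-- membership in `E`: integrable on `(0,∞)` with weight `1/(1+x)`. -/
def MemE (f : ℝ → ℂ) : Prop :=
  IntegrableOn (fun x : ℝ => f x / (1 + (x : ℂ))) (Ioi 0)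

/-- membership in `E_k`: integrable on `(0,∞)` with weight `x^{k-1}`. -/
def MemEk (k : ℝ) (f : ℝ → ℂ) : Prop :=
  IntegrableOn (fun x : ℝ => (x ^ (k - 1) : ℝ) • f x) (Ioi 0)

/-- membership in `B_{ε,η}`. -/
def MemB (ε η : ℝ) (f : ℝ → ℂ) : Prop :=
  ContinuousOn f (Ioi 0) ∧
  ∃ M : ℝ, (∀ x : ℝ, 1 < x → x ^ ε * ‖f x‖ ≤ M) ∧ (∀ x : ℝ, 0 < x → x < 1 → x ^ η * ‖f x‖ ≤ M)

/-- the norm of `B_{ε,η}`. -/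
def Bnorm (ε η : ℝ) (f : ℝ → ℂ) : ℝ :=
  sSup ((fun x : ℝ => x ^ ε * ‖f x‖) '' Ioi 1) + sSup ((fun x : ℝ => x ^ η * ‖f x‖) '' Ioo 0 1)

/-- admissible weight pair `(φ₁,φ₂)`. -/
def AdmissiblePair (φ₁ φ₂ : ℝ → ℝ) : Prop :=
  ContinuousOn φ₁ (Ioi 0) ∧ ContinuousOn φ₂ (Ioi 0) ∧
  (∀ y : ℝ, 0 < y → (φ₁ y ∈ Ioo (0:ℝ) 1 ∧ φ₂ y ∈ Ioo (0:ℝ) 1 ∧ φ₁ y + φ₂ y = 1)) ∧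
  φ₁ =O[Filter.atTop] (fun y : ℝ => 1 / y) ∧
  (fun y : ℝ => φ₁ y - 1) =O[nhdsWithin 0 (Ioi 0)] (fun y : ℝ => y)

/-- the combined kernel `R₂₃`. -/
def R23 (φ₁ φ₂ : ℝ → ℝ) (α : ℂ) (x y : ℝ) : ℂ :=
  (φ₁ y : ℂ) * R2 α x y + (φ₂ y : ℂ) * R3 α x y

theorem norm_le_of_memB {ε η M : ℝ} {f : ℝ → ℂ}
    (h₁ : ∀ y : ℝ, 1 ≤ y → ‖f y‖ ≤ M * y ^ (-ε))
    (h₂ : ∀ y : ℝ, 0 < y → y < 1 → ‖f y‖ ≤ M * y ^ (-η)) (hM : 0 ≤ M) {y : ℝ} (hy : 0 < y) :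
    ‖f y‖ ≤ M * (y ^ (-ε) + y ^ (-η)) := by
  have h1 := Real.rpow_nonneg hy.le (-ε)
  have h2 := Real.rpow_nonneg hy.le (-η)
  rcases le_or_gt 1 y with h | h
  · exact (h₁ y h).trans (by gcongr; linarith)
  · exact (h₂ y hy h).trans (by gcongr; linarith)

theorem MemB.exists_bound {ε η : ℝ} {f : ℝ → ℂ} (hf : MemB ε η f) :
    ∃ M : ℝ, 0 ≤ M ∧ (∀ y : ℝ, 1 ≤ y → ‖f y‖ ≤ M * y ^ (-ε)) ∧
      ∀ y : ℝ, 0 < y → y < 1 → ‖f y‖ ≤ M * y ^ (-η) := by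
  obtain ⟨-, M, h₁, h₂⟩ := hf
  refine ⟨max M ‖f 1‖, le_max_of_le_right (norm_nonneg _), fun y hy => ?_, fun y hy hy' => ?_⟩
  · have hy0 : 0 < y := by linarith
    rcases hy.eq_or_lt with rfl | hy
    · simp
    · rw [Real.rpow_neg hy0.le, ← div_eq_mul_inv, le_div_iff₀ (by positivity), mul_comm]
      exact (h₁ y hy).trans (le_max_left _ _)
  · rw [Real.rpow_neg hy.le, ← div_eq_mul_inv, le_div_iff₀ (by positivity), mul_comm]
    exact (h₂ y hy hy').trans (le_max_left _ _)

theorem rpow_mul_mul_rpow_neg {x u s t : ℝ} (hx : 0 < x) (hu : 0 < u) :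
    x ^ s * (x * u) ^ (-t) = x ^ (s - t) * u ^ (-t) := by
  rw [Real.mul_rpow hx.le hu.le, ← mul_assoc, ← Real.rpow_add hx, sub_eq_add_neg]

/-- On `1 < x` the weight `x ^ ε` turns the dilate `u ↦ f (x * u)` into a function bounded
uniformly in `x`. -/
theorem rpow_mul_norm_le_of_one_lt {ε η M : ℝ} {f : ℝ → ℂ} (hM : 0 ≤ M)
    (h₁ : ∀ y : ℝ, 1 ≤ y → ‖f y‖ ≤ M * y ^ (-ε))
    (h₂ : ∀ y : ℝ, 0 < y → y < 1 → ‖f y‖ ≤ M * y ^ (-η)) {x u : ℝ} (hx : 1 < x) (hu : 0 < u) :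
    x ^ ε * ‖f (x * u)‖ ≤ M * (u ^ (-ε) + u ^ (-η)) := by
  have hx0 : 0 < x := by linarith
  have hxu : 0 < x * u := mul_pos hx0 hu
  have hε := Real.rpow_nonneg hu.le (-ε)
  have hη := Real.rpow_nonneg hu.le (-η)
  have main : ∀ z, ‖f (x * u)‖ ≤ M * z → x ^ ε * z ≤ u ^ (-ε) + u ^ (-η) →
      x ^ ε * ‖f (x * u)‖ ≤ M * (u ^ (-ε) + u ^ (-η)) := fun z h h' =>
    calc x ^ ε * ‖f (x * u)‖ ≤ x ^ ε * (M * z) := by gcongr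
      _ = M * (x ^ ε * z) := by ring
      _ ≤ _ := by gcongr
  have key : x ^ ε * (x * u) ^ (-ε) ≤ u ^ (-ε) + u ^ (-η) := by
    rw [rpow_mul_mul_rpow_neg hx0 hu, sub_self, Real.rpow_zero]; linarith
  rcases le_or_gt 1 (x * u) with h | h
  · exact main _ (h₁ _ h) key
  · refine main _ (h₂ _ hxu h) ?_
    rcases le_or_gt ε η with h' | h'
    · rw [rpow_mul_mul_rpow_neg hx0 hu]
      have := Real.rpow_le_one_of_one_le_of_nonpos hx.le (sub_nonpos.2 h')
      nlinarith
    · refine le_trans ?_ key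
      gcongr ?_ * ?_
      exact Real.rpow_le_rpow_of_exponent_ge hxu h.le (by linarith)

theorem rpow_mul_norm_le_of_lt_one {ε η M : ℝ} {f : ℝ → ℂ} (hM : 0 ≤ M)
    (h₁ : ∀ y : ℝ, 1 ≤ y → ‖f y‖ ≤ M * y ^ (-ε))
    (h₂ : ∀ y : ℝ, 0 < y → y < 1 → ‖f y‖ ≤ M * y ^ (-η)) {x u : ℝ} (hx0 : 0 < x) (hx : x < 1)
    (hu : 0 < u) :
    x ^ η * ‖f (x * u)‖ ≤ M * (u ^ (-ε) + u ^ (-η)) := by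
  have hxu : 0 < x * u := mul_pos hx0 hu
  have hε := Real.rpow_nonneg hu.le (-ε)
  have hη := Real.rpow_nonneg hu.le (-η)
  have main : ∀ z, ‖f (x * u)‖ ≤ M * z → x ^ η * z ≤ u ^ (-ε) + u ^ (-η) →
      x ^ η * ‖f (x * u)‖ ≤ M * (u ^ (-ε) + u ^ (-η)) := fun z h h' =>
    calc x ^ η * ‖f (x * u)‖ ≤ x ^ η * (M * z) := by gcongr
      _ = M * (x ^ η * z) := by ring
      _ ≤ _ := by gcongr
  have key : x ^ η * (x * u) ^ (-η) ≤ u ^ (-ε) + u ^ (-η) := by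
    rw [rpow_mul_mul_rpow_neg hx0 hu, sub_self, Real.rpow_zero]; linarith
  rcases le_or_gt 1 (x * u) with h | h
  · refine main _ (h₁ _ h) ?_
    rcases le_or_gt ε η with h' | h'
    · rw [rpow_mul_mul_rpow_neg hx0 hu]
      have := Real.rpow_le_one hx0.le hx.le (sub_nonneg.2 h')
      nlinarith
    · refine le_trans ?_ key
      gcongr ?_ * ?_
      exact Real.rpow_le_rpow_of_exponent_le h (by linarith)
  · exact main _ (h₂ _ hxu h) key

/-- The convolution operator on the multiplicative group `(0, ∞)` with kernel `k` preserves
`B_{ε,η}` as soon as the moments of `k` of orders `ε` and `η` are finite. -/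
theorem MemB.convolution {ε η : ℝ} {f k : ℝ → ℂ} (hf : MemB ε η f) (hk : Measurable k)
    (hε : IntegrableOn (fun t : ℝ => t ^ (ε - 1) * ‖k t‖) (Ioi 0))
    (hη : IntegrableOn (fun t : ℝ => t ^ (η - 1) * ‖k t‖) (Ioi 0)) :
    (∀ x : ℝ, 0 < x → IntegrableOn (fun y : ℝ => 1 / (y : ℂ) * k (x / y) * f y) (Ioi 0)) ∧
      MemB ε η (fun x : ℝ => ∫ y in Ioi (0 : ℝ), 1 / (y : ℂ) * k (x / y) * f y) := by
  obtain ⟨M, hM, h₁, h₂⟩ := hf.exists_bound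
  set h : ℝ → ℂ := fun u => 1 / (u : ℂ) * k (1 / u) with hh
  have hmeas : Measurable h := by
    rw [hh]; fun_prop
  have moment : ∀ s : ℝ, IntegrableOn (fun t : ℝ => t ^ (s - 1) * ‖k t‖) (Ioi 0) →
      IntegrableOn (fun u : ℝ => ‖h u‖ * u ^ (-s)) (Ioi 0) := by
    intro s hs
    refine ((integrableOn_Ioi_comp_rpow_iff _ (neg_ne_zero.2 one_ne_zero)).2 hs).congr_fun ?_
      measurableSet_Ioi
    intro u hu
    have hu : (0 : ℝ) < u := hu
    have e : u ^ ((-1 : ℝ) - 1) * (u⁻¹) ^ (s - 1) = u⁻¹ * u ^ (-s) := by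
      rw [Real.inv_rpow hu.le, ← Real.rpow_neg hu.le, ← Real.rpow_neg_one u, ← Real.rpow_add hu,
        ← Real.rpow_add hu]
      ring_nf
    simp only [hh, norm_mul, Real.rpow_neg_one, abs_neg, abs_one, one_mul, smul_eq_mul,
      one_div, norm_inv, Complex.norm_real, Real.norm_eq_abs, abs_of_pos hu]
    rw [← mul_assoc, e]
    ring
  have hiε := moment ε hε
  have hiη := moment η hη
  have hfm : ∀ x : ℝ, 0 < x →
      AEStronglyMeasurable (fun u => h u * f (x * u)) (volume.restrict (Ioi 0)) := by
    intro x hx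
    refine hmeas.aestronglyMeasurable.mul (ContinuousOn.aestronglyMeasurable ?_ measurableSet_Ioi)
    exact hf.1.comp (by fun_prop) fun u hu => mul_pos hx hu
  have hsub : ∀ x : ℝ, 0 < x → ∀ u : ℝ, 0 < u →
      1 / ((x * u : ℝ) : ℂ) * k (x / (x * u)) * f (x * u) = (x : ℂ)⁻¹ * (h u * f (x * u)) := by
    intro x hx u hu
    have : x / (x * u) = 1 / u := by field_simp
    rw [this]
    simp only [hh]
    push_cast
    rw [one_div, one_div, mul_inv]
    ring
  have hbound : ∀ x : ℝ, 0 < x → ∀ u : ℝ, 0 < u →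
      ‖h u * f (x * u)‖ ≤
        M * (x ^ (-ε) * (‖h u‖ * u ^ (-ε)) + x ^ (-η) * (‖h u‖ * u ^ (-η))) := by
    intro x hx u hu
    rw [norm_mul]
    calc _ ≤ ‖h u‖ * (M * ((x * u) ^ (-ε) + (x * u) ^ (-η))) := by
            gcongr; exact norm_le_of_memB h₁ h₂ hM (mul_pos hx hu)
      _ = _ := by rw [Real.mul_rpow hx.le hu.le, Real.mul_rpow hx.le hu.le]; ring
  have hint : ∀ x : ℝ, 0 < x → IntegrableOn (fun u => h u * f (x * u)) (Ioi 0) := by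
    intro x hx
    refine Integrable.mono' (((hiε.const_mul (x ^ (-ε))).add (hiη.const_mul (x ^ (-η)))).const_mul M)
      (hfm x hx) ?_
    filter_upwards [ae_restrict_mem measurableSet_Ioi] with u hu using hbound x hx u hu
  have heq : ∀ x : ℝ, 0 < x → ∫ y in Ioi (0 : ℝ), 1 / (y : ℂ) * k (x / y) * f y =
      ∫ u in Ioi (0 : ℝ), h u * f (x * u) := by
    intro x hx
    have := integral_comp_mul_left_Ioi (fun y : ℝ => 1 / (y : ℂ) * k (x / y) * f y) 0 hx
    rw [mul_zero, setIntegral_congr_fun measurableSet_Ioi (fun u hu => hsub x hx u hu),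
      integral_const_mul, Complex.real_smul, Complex.ofReal_inv] at this
    exact (mul_left_cancel₀ (inv_ne_zero (Complex.ofReal_ne_zero.2 hx.ne')) this).symm
  have hweight : ∀ x w : ℝ, 0 < x → 0 ≤ w →
      (∀ u, 0 < u → w * ‖f (x * u)‖ ≤ M * (u ^ (-ε) + u ^ (-η))) →
      w * ‖∫ u in Ioi (0 : ℝ), h u * f (x * u)‖ ≤
        ∫ u in Ioi (0 : ℝ), M * (‖h u‖ * u ^ (-ε) + ‖h u‖ * u ^ (-η)) := by
    intro x w hx hw hle
    calc _ ≤ w * ∫ u in Ioi (0 : ℝ), ‖h u * f (x * u)‖ := by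
            gcongr; exact norm_integral_le_integral_norm _
      _ = ∫ u in Ioi (0 : ℝ), w * ‖h u * f (x * u)‖ := (integral_const_mul _ _).symm
      _ ≤ _ := by
        refine setIntegral_mono_on ((hint x hx).norm.const_mul w) ((hiε.add hiη).const_mul M)
          measurableSet_Ioi fun u hu => ?_
        rw [norm_mul]
        calc w * (‖h u‖ * ‖f (x * u)‖) = ‖h u‖ * (w * ‖f (x * u)‖) := by ring
          _ ≤ ‖h u‖ * (M * (u ^ (-ε) + u ^ (-η))) := 
            mul_le_mul_of_nonneg_left (hle u hu) (norm_nonneg _)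
          _ = _ := by ring
  refine ⟨fun x hx => ?_, ?_, ∫ u in Ioi (0 : ℝ), M * (‖h u‖ * u ^ (-ε) + ‖h u‖ * u ^ (-η)),
    fun x hx => ?_, fun x hx hx' => ?_⟩
  · have := integrableOn_Ioi_comp_mul_left_iff (fun y : ℝ => 1 / (y : ℂ) * k (x / y) * f y) 0 hx
    rw [mul_zero] at this
    refine this.1 (IntegrableOn.congr_fun ((hint x hx).const_mul (x : ℂ)⁻¹) ?_ measurableSet_Ioi)
    exact fun u hu => (hsub x hx u hu).symm
  · refine ContinuousOn.congr (f := fun x => ∫ u in Ioi (0 : ℝ), h u * f (x * u)) ?_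
      fun x hx => heq x hx
    intro x₀ hx₀
    have hx₀ : (0 : ℝ) < x₀ := hx₀
    refine (continuousAt_of_dominated (bound := fun u => M * ((x₀ ^ (-ε) + 1) * (‖h u‖ * u ^ (-ε)) +
      (x₀ ^ (-η) + 1) * (‖h u‖ * u ^ (-η)))) ?_ ?_ ?_ ?_).continuousWithinAt
    · filter_upwards [lt_mem_nhds hx₀] with x hx using hfm x hx
    · have hlt : ∀ s : ℝ, ∀ᶠ x in nhds x₀, x ^ s < x₀ ^ s + 1 := fun s =>
        (Real.continuousAt_rpow_const x₀ s (Or.inl hx₀.ne')).eventually_lt continuousAt_const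
          (by linarith)
      filter_upwards [lt_mem_nhds hx₀, hlt (-ε), hlt (-η)] with x hx hxε hxη
      filter_upwards [ae_restrict_mem measurableSet_Ioi] with u hu
      have hu : (0 : ℝ) < u := hu
      refine (hbound x hx u hu).trans ?_
      gcongr
    · exact ((hiε.const_mul _).add (hiη.const_mul _)).const_mul M
    · filter_upwards [ae_restrict_mem measurableSet_Ioi] with u hu
      have hc : ContinuousAt f (x₀ * u) := hf.1.continuousAt (Ioi_mem_nhds (mul_pos hx₀ hu))
      exact continuousAt_const.mul (hc.comp (f := fun x => x * u) (by fun_prop))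
  · have hx0 : 0 < x := by linarith
    dsimp only
    rw [heq x hx0]
    exact hweight x _ hx0 (by positivity) fun u hu => rpow_mul_norm_le_of_one_lt hM h₁ h₂ hx hu
  · dsimp only
    rw [heq x hx]
    exact hweight x _ hx (by positivity) fun u hu => rpow_mul_norm_le_of_lt_one hM h₁ h₂ hx hx' hu

theorem rpow_isBigO_rpow_nhdsGT_zero {s p : ℝ} (h : p ≤ s) :
    (fun t : ℝ => t ^ s) =O[nhdsWithin 0 (Ioi 0)] fun t : ℝ => t ^ p := by
  refine IsBigO.of_bound 1 ?_
  filter_upwards [Ioo_mem_nhdsGT one_pos] with t ht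
  rw [one_mul, Real.norm_of_nonneg (Real.rpow_nonneg ht.1.le _),
    Real.norm_of_nonneg (Real.rpow_nonneg ht.1.le _)]
  exact Real.rpow_le_rpow_of_exponent_ge ht.1 ht.2.le h

theorem rpow_isBigO_rpow_atTop {s p : ℝ} (h : s ≤ p) :
    (fun t : ℝ => t ^ s) =O[Filter.atTop] fun t : ℝ => t ^ p := by
  refine IsBigO.of_bound 1 ?_
  filter_upwards [Filter.eventually_ge_atTop 1] with t ht
  have ht0 : 0 ≤ t := by linarith
  rw [one_mul, Real.norm_of_nonneg (Real.rpow_nonneg ht0 _),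
    Real.norm_of_nonneg (Real.rpow_nonneg ht0 _)]
  exact Real.rpow_le_rpow_of_exponent_le ht h

theorem cpow_isBigO_rpow {l : Filter ℝ} (hl : ∀ᶠ t in l, 0 < t) (s : ℂ) :
    (fun t : ℝ => (t : ℂ) ^ s) =O[l] fun t : ℝ => t ^ s.re := by
  refine IsBigO.of_bound 1 ?_
  filter_upwards [hl] with t ht
  rw [Complex.norm_cpow_eq_rpow_re_of_pos ht, one_mul,
    Real.norm_of_nonneg (Real.rpow_nonneg ht.le _)]

theorem differentiableAt_ofReal_cpow (s : ℂ) {t : ℝ} (ht : 0 < t) :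
    DifferentiableAt ℝ (fun t : ℝ => (t : ℂ) ^ s) t := by
  have h : DifferentiableAt ℂ (fun z : ℂ => z ^ s) (t : ℂ) :=
    differentiableAt_id.cpow (differentiableAt_const s) (Complex.ofReal_mem_slitPlane.2 ht)
  exact (h.restrictScalars ℝ).comp t Complex.ofRealCLM.differentiableAt

/-- The singularity of `1 / (1 - t ^ 2)` at `t = 1` is removed by a zero of the numerator. -/
theorem integrableOn_rpow_mul_norm_div_one_sub_sq {N : ℝ → ℂ} {p q σ : ℝ}
    (hd : ∀ t : ℝ, 0 < t → DifferentiableAt ℝ N t) (h1 : N 1 = 0)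
    (h0 : N =O[nhdsWithin 0 (Ioi 0)] fun t : ℝ => t ^ p)
    (htop : N =O[Filter.atTop] fun t : ℝ => t ^ q) (hp : -p < σ) (hq : σ < 2 - q) :
    IntegrableOn (fun t : ℝ => t ^ (σ - 1) * ‖N t / (1 - (t : ℂ) ^ 2)‖) (Ioi 0) := by
  set g : ℝ → ℂ := fun t => -(((1 + t)⁻¹ : ℝ) • dslope N 1 t) with hg
  have hgN : ∀ t : ℝ, 0 < t → t ≠ 1 → g t = ((1 - t ^ 2)⁻¹ : ℝ) • N t := by
    intro t ht ht1
    have h₁ : t - 1 ≠ 0 := sub_ne_zero.2 ht1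
    have h₂ : 1 + t ≠ 0 := by positivity
    have h₃ : (1 + t)⁻¹ * (t - 1)⁻¹ = -(1 - t ^ 2)⁻¹ := by
      rw [← mul_inv, ← inv_neg]; ring_nf
    rw [hg]
    dsimp only
    rw [dslope_of_ne _ ht1, slope_def_module, h1, sub_zero, smul_smul, h₃, neg_smul, neg_neg]
  have hgc : ContinuousOn g (Ioi 0) := by
    have hN : ContinuousOn (dslope N 1) (Ioi 0) :=
      (continuousOn_dslope (Ioi_mem_nhds one_pos)).2
        ⟨fun t ht => (hd t ht).continuousAt.continuousWithinAt, hd 1 one_pos⟩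
    have hinv : ContinuousOn (fun t : ℝ => (1 + t)⁻¹) (Ioi 0) := by
      refine ContinuousOn.inv₀ (by fun_prop) fun t ht => ?_
      have ht : (0 : ℝ) < t := ht
      positivity
    exact (hinv.smul hN).neg
  have hg0 : g =O[nhdsWithin 0 (Ioi 0)] fun t : ℝ => t ^ (-(-p)) := by
    have hb : (fun t : ℝ => (1 - t ^ 2)⁻¹) =O[nhdsWithin 0 (Ioi 0)] fun _ => (1 : ℝ) := by
      have : ContinuousAt (fun t : ℝ => (1 - t ^ 2)⁻¹) 0 :=
        ContinuousAt.inv₀ (by fun_prop) (by norm_num)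
      exact (this.tendsto.mono_left nhdsWithin_le_nhds).isBigO_one ℝ
    refine ((hb.smul h0).congr' ?_ ?_)
    · filter_upwards [Ioo_mem_nhdsGT one_pos] with t ht using (hgN t ht.1 ht.2.ne).symm
    · exact Filter.Eventually.of_forall fun t => by simp
  have hgtop : g =O[Filter.atTop] fun t : ℝ => t ^ (-(2 - q)) := by
    have hb : (fun t : ℝ => (1 - t ^ 2)⁻¹) =O[Filter.atTop] fun t : ℝ => t ^ (-2 : ℝ) := by
      refine IsBigO.of_bound 2 ?_
      filter_upwards [Filter.eventually_ge_atTop 2] with t ht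
      have ht0 : 0 < t := by linarith
      have e : ‖(1 - t ^ 2)⁻¹‖ = (t ^ 2 - 1)⁻¹ := by
        rw [norm_inv, Real.norm_eq_abs, abs_sub_comm, abs_of_pos (by nlinarith)]
      rw [e, Real.norm_of_nonneg (Real.rpow_nonneg ht0.le _), Real.rpow_neg ht0.le,
        Real.rpow_two, ← div_eq_mul_inv, inv_eq_one_div,
        div_le_div_iff₀ (by nlinarith) (by positivity)]
      nlinarith
    refine ((hb.smul htop).congr' ?_ ?_)
    · filter_upwards [Filter.eventually_gt_atTop 1] with t ht
      exact (hgN t (by linarith) ht.ne').symm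
    · filter_upwards [Filter.eventually_gt_atTop 0] with t ht
      rw [smul_eq_mul, ← Real.rpow_add ht]
      ring_nf
  have main := mellin_convergent_of_isBigO_scalar
    (hgc.norm.locallyIntegrableOn measurableSet_Ioi) hgtop.norm_left hq hg0.norm_left hp
  refine Integrable.congr main ?_
  filter_upwards [ae_restrict_mem measurableSet_Ioi,
    ae_restrict_of_ae (Measure.ae_ne volume (1 : ℝ))] with t ht ht1
  rw [hgN t ht ht1, Complex.real_smul, div_eq_inv_mul]
  push_cast
  rfl

theorem measurable_r1 (α : ℂ) : Measurable (r1 α) := by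
  unfold r1
  split_ifs <;> fun_prop

theorem integrableOn_rpow_mul_norm_r1 {α : ℂ} {σ : ℝ} (hα : -(1 / 2) ≤ α.re) (hσ : α.re < σ)
    (hσ' : σ < 1 - α.re) : IntegrableOn (fun t : ℝ => t ^ (σ - 1) * ‖r1 α t‖) (Ioi 0) := by
  obtain ⟨p, hp, hp'⟩ : ∃ p, -σ < p ∧ p < -α.re := exists_between (by linarith)
  obtain ⟨q, hq, hq'⟩ : ∃ q, α.re + 1 < q ∧ q < 2 - σ := exists_between (by linarith)
  have zero_pos : ∀ᶠ t : ℝ in nhdsWithin 0 (Ioi 0), 0 < t := self_mem_nhdsWithin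
  have top_pos : ∀ᶠ t : ℝ in Filter.atTop, 0 < t := Filter.eventually_gt_atTop 0
  have scale : ∀ (c : ℂ) (N : ℝ → ℂ),
      (∀ t, r1 α t = c * (N t / (1 - (t : ℂ) ^ 2))) →
      IntegrableOn (fun t : ℝ => t ^ (σ - 1) * ‖N t / (1 - (t : ℂ) ^ 2)‖) (Ioi 0) →
      IntegrableOn (fun t : ℝ => t ^ (σ - 1) * ‖r1 α t‖) (Ioi 0) := by
    intro c N h hN
    refine IntegrableOn.congr_fun (Integrable.const_mul hN ‖c‖) (fun t _ => ?_) measurableSet_Ioi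
    simp only [h, norm_mul]
    ring
  by_cases hα' : α = -(1 / 2 : ℂ)
  · have hre : α.re = -(1 / 2) := by rw [hα']; norm_num
    rw [hre] at hp' hq
    refine scale (-(2 / (Real.pi : ℂ))) (fun t => (t : ℂ) ^ ((1 : ℂ) / 2) * (Real.log t : ℂ))
      (fun t => by rw [r1, if_pos hα', mul_div_assoc])
      (integrableOn_rpow_mul_norm_div_one_sub_sq (p := p) (q := q) (fun t ht => ?_) (by simp)
        ?_ ?_ (by linarith) (by linarith))
    · exact (differentiableAt_ofReal_cpow _ ht).mul
        (Complex.ofRealCLM.differentiableAt.comp t (Real.differentiableAt_log ht.ne'))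
    · have hlog : (fun t : ℝ => (Real.log t : ℂ)) =O[nhdsWithin 0 (Ioi 0)]
          fun t : ℝ => t ^ (p - 1 / 2) :=
        Complex.isBigO_ofReal_left.2 (isLittleO_log_rpow_nhdsGT_zero (by linarith)).isBigO
      refine ((cpow_isBigO_rpow zero_pos _).mul hlog).congr' .rfl ?_
      filter_upwards [zero_pos] with t ht
      rw [← Real.rpow_add ht]
      norm_num
    · have hlog : (fun t : ℝ => (Real.log t : ℂ)) =O[Filter.atTop]
          fun t : ℝ => t ^ (q - 1 / 2) :=
        Complex.isBigO_ofReal_left.2 (isLittleO_log_rpow_atTop (by linarith)).isBigO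
      refine ((cpow_isBigO_rpow top_pos _).mul hlog).congr' .rfl ?_
      filter_upwards [top_pos] with t ht
      rw [← Real.rpow_add ht]
      norm_num
  · refine scale (1 / Complex.cos ((Real.pi : ℂ) * α))
      (fun t => (t : ℂ) ^ (-α) - (t : ℂ) ^ (α + 1)) (fun t => by rw [r1, if_neg hα'])
      (integrableOn_rpow_mul_norm_div_one_sub_sq (p := p) (q := q) (fun t ht => ?_) (by simp)
        (.sub ?_ ?_) (.sub ?_ ?_) (by linarith) (by linarith))
    · exact (differentiableAt_ofReal_cpow _ ht).sub (differentiableAt_ofReal_cpow _ ht)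
    · exact (cpow_isBigO_rpow zero_pos _).trans
        (rpow_isBigO_rpow_nhdsGT_zero (by rw [Complex.neg_re]; linarith))
    · exact (cpow_isBigO_rpow zero_pos _).trans
        (rpow_isBigO_rpow_nhdsGT_zero (by rw [Complex.add_re, Complex.one_re]; linarith))
    · exact (cpow_isBigO_rpow top_pos _).trans
        (rpow_isBigO_rpow_atTop (by rw [Complex.neg_re]; linarith))
    · exact (cpow_isBigO_rpow top_pos _).trans
        (rpow_isBigO_rpow_atTop (by rw [Complex.add_re, Complex.one_re]; linarith))

theorem measurable_r2 (α : ℂ) : Measurable (r2 α) := by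
  have := measurable_r1 (-α)
  unfold r2
  fun_prop

theorem measurable_r3 (α : ℂ) : Measurable (r3 α) := by
  have := measurable_r2 α
  unfold r3
  fun_prop

theorem integrableOn_rpow_mul_norm_r2 {α : ℂ} {s : ℝ} (hα : α.re ≤ 1 / 2) (hs : 1 - α.re < s)
    (hs' : s < 2 + α.re) : IntegrableOn (fun t : ℝ => t ^ (s - 1) * ‖r2 α t‖) (Ioi 0) := by
  have h := integrableOn_rpow_mul_norm_r1 (α := -α) (σ := s - 1)
    (by rw [Complex.neg_re]; linarith) (by rw [Complex.neg_re]; linarith)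
    (by rw [Complex.neg_re]; linarith)
  refine h.congr_fun (fun t ht => ?_) measurableSet_Ioi
  have ht : (0 : ℝ) < t := ht
  simp only [r2, norm_mul, norm_neg, one_div, norm_inv, Complex.norm_real,
    Real.norm_of_nonneg ht.le]
  rw [Real.rpow_sub_one ht.ne' (s - 1)]
  ring

theorem integrableOn_rpow_mul_norm_r3 {α : ℂ} {s : ℝ} (hα : α.re ≤ 1 / 2) (hs : -α.re < s + 1)
    (hs' : s < α.re) : IntegrableOn (fun t : ℝ => t ^ (s - 1) * ‖r3 α t‖) (Ioi 0) := by
  have h := integrableOn_rpow_mul_norm_r1 (α := -α) (σ := s + 1)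
    (by rw [Complex.neg_re]; linarith) (by rw [Complex.neg_re]; linarith)
    (by rw [Complex.neg_re]; linarith)
  refine h.congr_fun (fun t ht => ?_) measurableSet_Ioi
  have ht : (0 : ℝ) < t := ht
  simp only [r3, r2, norm_mul, norm_neg, one_div, norm_inv, norm_pow, Complex.norm_real,
    Real.norm_of_nonneg ht.le]
  rw [show s + 1 - 1 = s - 1 + 1 by ring, Real.rpow_add_one ht.ne']
  field_simp

/-- Proposition 5: invariance of `B_{ε,η}` under the resolvent
operators `R₁^α`, `R₂^α`, `R₃^α` in the indicated parameter ranges. -/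
theorem stmt17 (α : ℂ) (ε η : ℝ) :
    ((-(1/2) ≤ α.re ∧ α.re < 0 ∧ 0 < ε ∧ ε < 1 ∧ 0 < η ∧ η < 1) →
      ∀ f : ℝ → ℂ, MemB ε η f →
        (∀ x : ℝ, 0 < x → IntegrableOn (fun y : ℝ => R1 α x y * f y) (Ioi 0)) ∧
        MemB ε η (fun x : ℝ => ∫ y in Ioi (0 : ℝ), R1 α x y * f y)) ∧
    ((0 < α.re ∧ α.re ≤ 1/2 ∧ 1 - α.re < ε ∧ ε < 1 ∧ 1 - α.re < η ∧ η < 1) →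
      ∀ f : ℝ → ℂ, MemB ε η f →
        (∀ x : ℝ, 0 < x → IntegrableOn (fun y : ℝ => R2 α x y * f y) (Ioi 0)) ∧
        MemB ε η (fun x : ℝ => ∫ y in Ioi (0 : ℝ), R2 α x y * f y)) ∧
    ((0 < α.re ∧ α.re ≤ 1/2 ∧ 0 < ε ∧ ε < α.re ∧ 0 < η ∧ η < α.re) →
      ∀ f : ℝ → ℂ, MemB ε η f →
        (∀ x : ℝ, 0 < x → IntegrableOn (fun y : ℝ => R3 α x y * f y) (Ioi 0)) ∧
        MemB ε η (fun x : ℝ => ∫ y in Ioi (0 : ℝ), R3 α x y * f y)) := by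
  refine ⟨fun ⟨hα, hα', hε, hε', hη, hη'⟩ f hf => ?_, fun ⟨hα, hα', hε, hε', hη, hη'⟩ f hf => ?_,
    fun ⟨hα, hα', hε, hε', hη, hη'⟩ f hf => ?_⟩
  · exact hf.convolution (measurable_r1 α)
      (integrableOn_rpow_mul_norm_r1 hα (by linarith) (by linarith))
      (integrableOn_rpow_mul_norm_r1 hα (by linarith) (by linarith))
  · exact hf.convolution (measurable_r2 α)
      (integrableOn_rpow_mul_norm_r2 hα' hε (by linarith))
      (integrableOn_rpow_mul_norm_r2 hα' hη (by linarith))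
  · exact hf.convolution (measurable_r3 α)
      (integrableOn_rpow_mul_norm_r3 hα' (by linarith) hε')
      (integrableOn_rpow_mul_norm_r3 hα' (by linarith) hη')

end
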